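/- arXiv:1407.6698 — 5 statements merged into one kernel-verified Lean document; each statement's English description precedes it below -/
import Mathlib

section
/- Let n ≥ 1 and let B : ℂⁿ × ℂⁿ → ℂ be a symmetric ℂ-bilinear form. For A = !![a, b; c, d] ∈ SL(2, ℝ) define A ∗ (τ, h, z) = ((aτ + b)/(cτ + d), h/(cτ + d), z·exp(−πi·(c/(cτ + d))·B(h, h))) for (τ, h, z) ∈ ℍ × ℂⁿ × ℂ. Then this is a left group action of SL(2, ℝ): the identity matrix acts trivially and (A₁A₂) ∗ (τ, h, z) = A₁ ∗ (A₂ ∗ (τ, h, z)) for all A₁, A₂ ∈ SL(2, ℝ). -/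
noncomputable section

/-- The Möbius action of `A = !![a, b; c, d] ∈ SL(2, ℝ)` on `τ`:
`A ∗ τ = (aτ + b)/(cτ + d)`. -/
def sl2RTau (A : Matrix.SpecialLinearGroup (Fin 2) ℝ) (τ : ℂ) : ℂ :=
  ((A.1 0 0 : ℂ) * τ + (A.1 0 1 : ℂ)) / ((A.1 1 0 : ℂ) * τ + (A.1 1 1 : ℂ))

/-- The action of `A = !![a, b; c, d] ∈ SL(2, ℝ)` on `ℍ × ℂⁿ × ℂ`:
`A ∗ (τ, h, z) = ((aτ + b)/(cτ + d), h/(cτ + d), z·exp(−πi·(c/(cτ + d))·B(h, h)))`. -/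
def sl2LineAct {n : ℕ} (B : (Fin n → ℂ) →ₗ[ℂ] (Fin n → ℂ) →ₗ[ℂ] ℂ)
    (A : Matrix.SpecialLinearGroup (Fin 2) ℝ) (x : ℂ × (Fin n → ℂ) × ℂ) :
    ℂ × (Fin n → ℂ) × ℂ :=
  (sl2RTau A x.1,
   (((A.1 1 0 : ℂ) * x.1 + (A.1 1 1 : ℂ))⁻¹) • x.2.1,
   x.2.2 * Complex.exp (-(Real.pi : ℂ) * Complex.I *
      ((A.1 1 0 : ℂ) / ((A.1 1 0 : ℂ) * x.1 + (A.1 1 1 : ℂ))) * B x.2.1 x.2.1))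

/-- The automorphy factor `cτ + d` of `A = !![a, b; c, d] ∈ SL(2, ℝ)`. -/
def sl2RDenom (A : Matrix.SpecialLinearGroup (Fin 2) ℝ) (τ : ℂ) : ℂ :=
  (A.1 1 0 : ℂ) * τ + (A.1 1 1 : ℂ)

lemma sl2R_det (A : Matrix.SpecialLinearGroup (Fin 2) ℝ) :
    A.1 0 0 * A.1 1 1 - A.1 0 1 * A.1 1 0 = 1 := by
  rw [← Matrix.det_fin_two, A.2]

lemma sl2RDenom_ne_zero (A : Matrix.SpecialLinearGroup (Fin 2) ℝ) {τ : ℂ} (hτ : 0 < τ.im) :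
    sl2RDenom A τ ≠ 0 := by
  intro h
  have him := congrArg Complex.im h
  have hre := congrArg Complex.re h
  simp only [sl2RDenom, Complex.add_im, Complex.im_ofReal_mul, Complex.ofReal_im, add_zero,
    Complex.zero_im, mul_eq_zero, hτ.ne', or_false] at him
  simp only [sl2RDenom, him, Complex.ofReal_zero, zero_mul, zero_add, Complex.ofReal_re,
    Complex.zero_re] at hre
  simpa [him, hre] using sl2R_det A

lemma sl2RTau_im (A : Matrix.SpecialLinearGroup (Fin 2) ℝ) (τ : ℂ) :
    (sl2RTau A τ).im = τ.im / Complex.normSq (sl2RDenom A τ) := by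
  change (_ / sl2RDenom A τ).im = _
  rw [Complex.div_im, ← sub_div]
  congr 1
  simp only [sl2RDenom, Complex.add_im, Complex.add_re, Complex.im_ofReal_mul,
    Complex.re_ofReal_mul, Complex.ofReal_im, Complex.ofReal_re]
  linear_combination τ.im * sl2R_det A

lemma sl2RTau_im_pos (A : Matrix.SpecialLinearGroup (Fin 2) ℝ) {τ : ℂ} (hτ : 0 < τ.im) :
    0 < (sl2RTau A τ).im := by
  rw [sl2RTau_im]
  exact div_pos hτ (Complex.normSq_pos.2 (sl2RDenom_ne_zero A hτ))

lemma sl2RDenom_mul (A₁ A₂ : Matrix.SpecialLinearGroup (Fin 2) ℝ) {τ : ℂ} (hτ : 0 < τ.im) :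
    sl2RDenom (A₁ * A₂) τ = sl2RDenom A₁ (sl2RTau A₂ τ) * sl2RDenom A₂ τ := by
  have h₂ := sl2RDenom_ne_zero A₂ hτ
  simp only [sl2RDenom, sl2RTau, Matrix.SpecialLinearGroup.coe_mul, Matrix.mul_apply,
    Fin.sum_univ_two] at h₂ ⊢
  push_cast
  field_simp
  ring

lemma sl2RTau_mul (A₁ A₂ : Matrix.SpecialLinearGroup (Fin 2) ℝ) {τ : ℂ} (hτ : 0 < τ.im) :
    sl2RTau (A₁ * A₂) τ = sl2RTau A₁ (sl2RTau A₂ τ) := by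
  have h₂ := sl2RDenom_ne_zero A₂ hτ
  have h₁ := sl2RDenom_ne_zero A₁ (sl2RTau_im_pos A₂ hτ)
  change _ / sl2RDenom (A₁ * A₂) τ = _ / sl2RDenom A₁ (sl2RTau A₂ τ)
  rw [sl2RDenom_mul A₁ A₂ hτ, div_eq_div_iff (mul_ne_zero h₁ h₂) h₁]
  have key : sl2RTau A₂ τ * sl2RDenom A₂ τ = (A₂.1 0 0 : ℂ) * τ + (A₂.1 0 1 : ℂ) :=
    div_mul_cancel₀ _ h₂
  simp only [Matrix.SpecialLinearGroup.coe_mul, Matrix.mul_apply, Fin.sum_univ_two]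
  push_cast
  have hd : sl2RDenom A₂ τ = (A₂.1 1 0 : ℂ) * τ + (A₂.1 1 1 : ℂ) := rfl
  linear_combination (-(A₁.1 0 0 : ℂ) * sl2RDenom A₁ (sl2RTau A₂ τ)) * key -
    (A₁.1 0 1 : ℂ) * sl2RDenom A₁ (sl2RTau A₂ τ) * hd

/-- The cocycle relation for `c / (cτ + d)`. -/
lemma sl2R_div_denom_mul (A₁ A₂ : Matrix.SpecialLinearGroup (Fin 2) ℝ) {τ : ℂ}
    (hτ : 0 < τ.im) :
    ((A₁ * A₂).1 1 0 : ℂ) / sl2RDenom (A₁ * A₂) τ =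
      (A₂.1 1 0 : ℂ) / sl2RDenom A₂ τ +
        (A₁.1 1 0 : ℂ) / sl2RDenom A₁ (sl2RTau A₂ τ) * (sl2RDenom A₂ τ)⁻¹ ^ 2 := by
  have h₂ := sl2RDenom_ne_zero A₂ hτ
  have h₁ := sl2RDenom_ne_zero A₁ (sl2RTau_im_pos A₂ hτ)
  have hm := sl2RDenom_mul A₁ A₂ hτ
  have hdet : (A₂.1 0 0 : ℂ) * A₂.1 1 1 - A₂.1 0 1 * A₂.1 1 0 = 1 := by
    exact_mod_cast sl2R_det A₂
  rw [hm]
  field_simp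
  rw [← hm]
  simp only [sl2RDenom, Matrix.SpecialLinearGroup.coe_mul, Matrix.mul_apply, Fin.sum_univ_two]
  push_cast
  linear_combination (A₁.1 1 0 : ℂ) * hdet

/-- For a symmetric ℂ-bilinear form `B` on `ℂⁿ`, the formula
`A ∗ (τ, h, z) = ((aτ + b)/(cτ + d), h/(cτ + d), z·exp(−πi·(c/(cτ + d))·B(h, h)))` defines a
left action of `SL(2, ℝ)` on `ℍ × ℂⁿ × ℂ`: the identity acts trivially, the upper half plane
is preserved, and `(A₁A₂) ∗ x = A₁ ∗ (A₂ ∗ x)`. -/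
theorem statement3 (n : ℕ) (hn : 1 ≤ n)
    (B : (Fin n → ℂ) →ₗ[ℂ] (Fin n → ℂ) →ₗ[ℂ] ℂ)
    (hB : ∀ x y : Fin n → ℂ, B x y = B y x) :
    (∀ x : ℂ × (Fin n → ℂ) × ℂ, 0 < x.1.im → sl2LineAct B 1 x = x) ∧
    (∀ (A : Matrix.SpecialLinearGroup (Fin 2) ℝ) (x : ℂ × (Fin n → ℂ) × ℂ),
      0 < x.1.im → 0 < (sl2LineAct B A x).1.im) ∧
    (∀ (A₁ A₂ : Matrix.SpecialLinearGroup (Fin 2) ℝ) (x : ℂ × (Fin n → ℂ) × ℂ),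
      0 < x.1.im → sl2LineAct B (A₁ * A₂) x = sl2LineAct B A₁ (sl2LineAct B A₂ x)) := by
  refine ⟨fun x _ => by simp [sl2LineAct, sl2RTau],
    fun A x hx => sl2RTau_im_pos A hx, fun A₁ A₂ x hx => ?_⟩
  refine Prod.ext (sl2RTau_mul A₁ A₂ hx) (Prod.ext ?_ ?_)
  · change (sl2RDenom (A₁ * A₂) x.1)⁻¹ • x.2.1 =
      (sl2RDenom A₁ (sl2RTau A₂ x.1))⁻¹ • (sl2RDenom A₂ x.1)⁻¹ • x.2.1
    rw [smul_smul, sl2RDenom_mul A₁ A₂ hx, mul_inv]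
  · change x.2.2 * Complex.exp (-(Real.pi : ℂ) * Complex.I *
        (((A₁ * A₂).1 1 0 : ℂ) / sl2RDenom (A₁ * A₂) x.1) * B x.2.1 x.2.1) =
      x.2.2 * Complex.exp (-(Real.pi : ℂ) * Complex.I *
        ((A₂.1 1 0 : ℂ) / sl2RDenom A₂ x.1) * B x.2.1 x.2.1) *
      Complex.exp (-(Real.pi : ℂ) * Complex.I *
        ((A₁.1 1 0 : ℂ) / sl2RDenom A₁ (sl2RTau A₂ x.1)) *
        B ((sl2RDenom A₂ x.1)⁻¹ • x.2.1) ((sl2RDenom A₂ x.1)⁻¹ • x.2.1))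
    rw [mul_assoc x.2.2, ← Complex.exp_add, sl2R_div_denom_mul A₁ A₂ hx]
    simp only [map_smul, LinearMap.smul_apply, smul_eq_mul]
    congr 2
    ring
end
end

section
/- Let n ≥ 1, let B be a symmetric bilinear form on ℝⁿ taking integer values on ℤⁿ (extended ℂ-bilinearly to ℂⁿ), and let W be a subgroup of GL(n, ℤ) preserving B, i.e. B(w(x), w(y)) = B(x, y) for all w ∈ W. Form the semidirect product 𝒩 = (ℤⁿ × ℤⁿ) ⋊ W with W acting diagonally. Then the formula ((β₁, β₂)·w) ∗ (τ, h, z) = (τ, w(h) + τ·β₁ + β₂, z·exp(2πi·B(β₁, w(h)) + πi·τ·B(β₁, β₁))) defines a left group action of 𝒩 on ℍ × ℂⁿ × ℂ. -/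
noncomputable section

/-- An integer vector viewed inside `ℂⁿ`. -/
def zc {n : ℕ} (β : Fin n → ℤ) : Fin n → ℂ := fun i => (β i : ℂ)

/-- The action of `w ∈ GL(n, ℤ)` on `ℂⁿ` by extension of scalars. -/
def glAct {n : ℕ} (w : Matrix.GeneralLinearGroup (Fin n) ℤ) (h : Fin n → ℂ) : Fin n → ℂ :=
  ((w : Matrix (Fin n) (Fin n) ℤ).map (fun a => (a : ℂ))).mulVec h

/-- The action of an element `((β₁, β₂), w)` of `𝒩 = (ℤⁿ × ℤⁿ) ⋊ W` on `ℍ × ℂⁿ × ℂ`: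
`((β₁, β₂)·w) ∗ (τ, h, z) =
  (τ, w(h) + τ·β₁ + β₂, z·exp(2πi·B(β₁, w(h)) + πi·τ·B(β₁, β₁)))`. -/
def nLineAct {n : ℕ} (B : (Fin n → ℂ) →ₗ[ℂ] (Fin n → ℂ) →ₗ[ℂ] ℂ)
    (g : ((Fin n → ℤ) × (Fin n → ℤ)) × Matrix.GeneralLinearGroup (Fin n) ℤ)
    (x : ℂ × (Fin n → ℂ) × ℂ) : ℂ × (Fin n → ℂ) × ℂ :=
  (x.1, glAct g.2 x.2.1 + x.1 • zc g.1.1 + zc g.1.2,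
   x.2.2 * Complex.exp (2 * (Real.pi : ℂ) * Complex.I * B (zc g.1.1) (glAct g.2 x.2.1)
      + (Real.pi : ℂ) * Complex.I * x.1 * B (zc g.1.1) (zc g.1.1)))

theorem zc_zero {n : ℕ} : zc (0 : Fin n → ℤ) = 0 := by
  ext i
  simp [zc]

theorem zc_add {n : ℕ} (β γ : Fin n → ℤ) : zc (β + γ) = zc β + zc γ := by
  ext i
  simp [zc]

theorem zc_mulVec {n : ℕ} (w : Matrix.GeneralLinearGroup (Fin n) ℤ) (β : Fin n → ℤ) :
    zc ((w : Matrix (Fin n) (Fin n) ℤ).mulVec β) = glAct w (zc β) := by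
  ext i
  simp [zc, glAct, Matrix.mulVec, dotProduct]

theorem glAct_one {n : ℕ} (h : Fin n → ℂ) : glAct 1 h = h := by
  simp [glAct]

theorem glAct_mul {n : ℕ} (w v : Matrix.GeneralLinearGroup (Fin n) ℤ) (h : Fin n → ℂ) :
    glAct (w * v) h = glAct w (glAct v h) := by
  have hmap : ((w * v : Matrix.GeneralLinearGroup (Fin n) ℤ) : Matrix (Fin n) (Fin n) ℤ).map
      (fun a => (a : ℂ)) = (w : Matrix (Fin n) (Fin n) ℤ).map (fun a => (a : ℂ)) *
        (v : Matrix (Fin n) (Fin n) ℤ).map (fun a => (a : ℂ)) :=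
    Matrix.map_mul (f := Int.castRingHom ℂ)
  simp only [glAct, hmap, Matrix.mulVec_mulVec]

theorem glAct_add {n : ℕ} (w : Matrix.GeneralLinearGroup (Fin n) ℤ) (x y : Fin n → ℂ) :
    glAct w (x + y) = glAct w x + glAct w y :=
  Matrix.mulVec_add _ _ _

theorem glAct_smul {n : ℕ} (w : Matrix.GeneralLinearGroup (Fin n) ℤ) (c : ℂ) (x : Fin n → ℂ) :
    glAct w (c • x) = c • glAct w x :=
  Matrix.mulVec_smul _ _ _

/-- For a symmetric bilinear form `B` (the ℂ-bilinear extension of a form taking integer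
values on `ℤⁿ`) preserved by a subgroup `W ≤ GL(n, ℤ)`, the formula
`((β₁, β₂)·w) ∗ (τ, h, z) = (τ, w(h) + τ·β₁ + β₂, z·exp(2πi·B(β₁, w(h)) + πi·τ·B(β₁, β₁)))`
defines a left action of `𝒩 = (ℤⁿ × ℤⁿ) ⋊ W` on `ℍ × ℂⁿ × ℂ`, the multiplication in `𝒩`
being `((β₁,β₂),w)·((γ₁,γ₂),v) = ((β₁ + w γ₁, β₂ + w γ₂), w v)`. -/
theorem statement4 (n : ℕ) (hn : 1 ≤ n)
    (W : Subgroup (Matrix.GeneralLinearGroup (Fin n) ℤ))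
    (B : (Fin n → ℂ) →ₗ[ℂ] (Fin n → ℂ) →ₗ[ℂ] ℂ)
    (hsymm : ∀ x y : Fin n → ℂ, B x y = B y x)
    (hint : ∀ β γ : Fin n → ℤ, ∃ m : ℤ, B (zc β) (zc γ) = (m : ℂ))
    (hW : ∀ w : Matrix.GeneralLinearGroup (Fin n) ℤ, w ∈ W →
      ∀ x y : Fin n → ℂ, B (glAct w x) (glAct w y) = B x y) :
    (∀ x : ℂ × (Fin n → ℂ) × ℂ, 0 < x.1.im → nLineAct B ((0, 0), 1) x = x) ∧
    (∀ w v : Matrix.GeneralLinearGroup (Fin n) ℤ, w ∈ W → v ∈ W →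
      ∀ (β₁ β₂ γ₁ γ₂ : Fin n → ℤ) (x : ℂ × (Fin n → ℂ) × ℂ), 0 < x.1.im →
        nLineAct B ((β₁ + (w : Matrix (Fin n) (Fin n) ℤ).mulVec γ₁,
                     β₂ + (w : Matrix (Fin n) (Fin n) ℤ).mulVec γ₂), w * v) x
          = nLineAct B ((β₁, β₂), w) (nLineAct B ((γ₁, γ₂), v) x)) := by
  refine ⟨?_, ?_⟩
  · rintro ⟨τ, h, z⟩ -
    simp [nLineAct, zc_zero, glAct_one]
  · rintro w v hw - β₁ β₂ γ₁ γ₂ ⟨τ, h, z⟩ -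
    simp only [nLineAct, zc_add, zc_mulVec, glAct_mul, glAct_add, glAct_smul]
    refine Prod.ext rfl (Prod.ext ?_ ?_)
    · simp only [smul_add]
      abel
    · obtain ⟨m, hm⟩ := hint β₁ ((w : Matrix (Fin n) (Fin n) ℤ).mulVec γ₂)
      rw [zc_mulVec] at hm
      dsimp only
      rw [mul_assoc z, ← Complex.exp_add]
      congr 1
      refine (Complex.exp_eq_exp_iff_exists_int).2 ⟨-m, ?_⟩
      simp only [map_add, map_smul, LinearMap.add_apply, smul_eq_mul, hW w hw, hm,
        hsymm (glAct w (zc γ₁)) (zc β₁)]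
      push_cast
      ring
end
end

section
/- Let n ≥ 1 and let B be a symmetric bilinear form on ℝⁿ that is positive definite and takes integer values on the lattice ℤⁿ ⊂ ℝⁿ; denote also by B its ℂ-bilinear extension to ℂⁿ. Then for every integer k ≥ 1, every τ ∈ ℍ and every h ∈ ℂⁿ, the family β ↦ exp(2πik·B(β, h) + πik·τ·B(β, β)) indexed by β ∈ ℤⁿ is summable (i.e. the theta series θ_k(τ, h) converges absolutely). -/
noncomputable section

/-- A real vector viewed inside `ℂⁿ`. -/
def rc {n : ℕ} (x : Fin n → ℝ) : Fin n → ℂ := fun i => (x i : ℂ)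

/-- The `β`-th term of the level `k` theta series:
`exp(2πik·B(β, h) + πik·τ·B(β, β))`. -/
def thetaTerm {n : ℕ} (B : (Fin n → ℂ) →ₗ[ℂ] (Fin n → ℂ) →ₗ[ℂ] ℂ)
    (k : ℤ) (τ : ℂ) (h : Fin n → ℂ) (β : Fin n → ℤ) : ℂ :=
  Complex.exp (2 * (Real.pi : ℂ) * Complex.I * (k : ℂ) * B (zc β) h
    + (Real.pi : ℂ) * Complex.I * (k : ℂ) * τ * B (zc β) (zc β))

/-- The level `k` theta function `θ_k(τ, h) = Σ_{β ∈ ℤⁿ} exp(2πik·B(β, h) + πik·τ·B(β, β))`. -/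
def theta {n : ℕ} (B : (Fin n → ℂ) →ₗ[ℂ] (Fin n → ℂ) →ₗ[ℂ] ℂ)
    (k : ℤ) (τ : ℂ) (h : Fin n → ℂ) : ℂ :=
  ∑' β : Fin n → ℤ, thetaTerm B k τ h β

/-- A product of nonnegative summable families is summable over the product index set. -/
theorem summable_prod_apply_of_nonneg {ι κ : Type*} [Fintype ι] (f : ι → κ → ℝ)
    (hf : ∀ i m, 0 ≤ f i m) (hs : ∀ i, Summable (f i)) :
    Summable (fun β : ι → κ => ∏ i, f i (β i)) := by
  classical
  refine summable_of_sum_le (c := ∏ i, ∑' m, f i m)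
    (fun β => Finset.prod_nonneg fun i _ => hf i _) fun u => ?_
  calc ∑ β ∈ u, ∏ i, f i (β i)
      ≤ ∑ β ∈ Fintype.piFinset fun i => u.image fun β => β i, ∏ i, f i (β i) := by
        refine Finset.sum_le_sum_of_subset_of_nonneg (fun β hβ => ?_)
          fun β _ _ => Finset.prod_nonneg fun i _ => hf i _
        exact Fintype.mem_piFinset.2 fun i => Finset.mem_image_of_mem (fun β => β i) hβ
    _ = ∏ i, ∑ m ∈ u.image fun β => β i, f i m := (Finset.prod_univ_sum _ _).symm
    _ ≤ ∏ i, ∑' m, f i m := Finset.prod_le_prod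
        (fun i _ => Finset.sum_nonneg fun m _ => hf i m)
        fun i _ => (hs i).sum_le_tsum _ fun m _ => hf i m

theorem summable_exp_neg_mul_sq_add_mul_int {a : ℝ} (ha : 0 < a) (b : ℝ) :
    Summable (fun m : ℤ => Real.exp (-a * (m : ℝ) ^ 2 + b * m)) := by
  have h := (summable_jacobiTheta₂_term_iff (⟨0, -b / (2 * Real.pi)⟩ : ℂ)
    (⟨0, a / Real.pi⟩ : ℂ)).2 (div_pos ha Real.pi_pos)
  refine h.norm.congr fun m => ?_
  rw [norm_jacobiTheta₂_term]
  congr 1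
  field_simp
  ring

/-- A positive definite bilinear form on `ℝⁿ` dominates a multiple of the standard one. -/
theorem exists_pos_mul_sum_sq_le {n : ℕ} (A : (Fin n → ℝ) →ₗ[ℝ] (Fin n → ℝ) →ₗ[ℝ] ℝ)
    (hpos : ∀ x : Fin n → ℝ, x ≠ 0 → 0 < A x x) :
    ∃ c : ℝ, 0 < c ∧ ∀ x : Fin n → ℝ, c * ∑ i, x i ^ 2 ≤ A x x := by
  have hcont : Continuous fun x : Fin n → ℝ => A x x :=
    ((LinearMap.toContinuousLinearMap.toLinearMap ∘ₗ A).continuous_of_finiteDimensional).clm_apply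
      continuous_id
  have hsq : Continuous fun x : Fin n → ℝ => ∑ i, x i ^ 2 := by fun_prop
  obtain ⟨C, hC⟩ : ∃ C : ℝ, ∀ x ∈ Metric.sphere (0 : Fin n → ℝ) 1,
      (∑ i, x i ^ 2) / A x x ≤ C := by
    obtain ⟨C, hC⟩ := (isCompact_sphere (0 : Fin n → ℝ) 1).bddAbove_image
      (hsq.continuousOn.div hcont.continuousOn fun x hx =>
        (hpos x (ne_zero_of_mem_unit_sphere ⟨x, hx⟩)).ne')
    exact ⟨C, fun x hx => hC ⟨x, hx, rfl⟩⟩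
  have hM : 0 < max C 1 := lt_max_of_lt_right one_pos
  refine ⟨(max C 1)⁻¹, inv_pos.2 hM, fun x => ?_⟩
  rcases eq_or_ne x 0 with rfl | hx
  · simp
  have hnx : 0 < ‖x‖ := norm_pos_iff.2 hx
  have hmem : ‖x‖⁻¹ • x ∈ Metric.sphere (0 : Fin n → ℝ) 1 := by
    simp [norm_smul, hnx.ne']
  have hle := (hC _ hmem).trans (le_max_left C 1)
  have hquot : (∑ i, (‖x‖⁻¹ • x) i ^ 2) / A (‖x‖⁻¹ • x) (‖x‖⁻¹ • x)
      = (∑ i, x i ^ 2) / A x x := by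
    simp only [Pi.smul_apply, smul_eq_mul, mul_pow, ← Finset.mul_sum, map_smul,
      LinearMap.smul_apply]
    have := (hpos x hx).ne'
    field_simp
  rw [hquot, div_le_iff₀ (hpos x hx)] at hle
  rwa [inv_mul_le_iff₀ hM]

theorem norm_thetaTerm {n : ℕ} {A : (Fin n → ℝ) →ₗ[ℝ] (Fin n → ℝ) →ₗ[ℝ] ℝ}
    {B : (Fin n → ℂ) →ₗ[ℂ] (Fin n → ℂ) →ₗ[ℂ] ℂ}
    (hext : ∀ x y : Fin n → ℝ, B (rc x) (rc y) = (A x y : ℂ))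
    (k : ℤ) (τ : ℂ) (h : Fin n → ℂ) (β : Fin n → ℤ) :
    ‖thetaTerm B k τ h β‖ =
      Real.exp (-(2 * Real.pi * k) * A (fun i => (β i : ℝ)) (fun i => (h i).im)
        - Real.pi * k * τ.im * A (fun i => (β i : ℝ)) (fun i => (β i : ℝ))) := by
  have hβ : zc β = rc fun i => (β i : ℝ) := by
    ext i
    simp [zc, rc]
  have hh : h = rc (fun i => (h i).re) + Complex.I • rc (fun i => (h i).im) := by
    ext i
    simp [rc, mul_comm Complex.I, Complex.re_add_im]
  have hBh : B (zc β) h = (A (fun i => (β i : ℝ)) (fun i => (h i).re) : ℂ)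
      + Complex.I * (A (fun i => (β i : ℝ)) (fun i => (h i).im) : ℂ) := by
    conv_lhs => rw [hh]
    rw [map_add, map_smul, hβ, hext, hext, smul_eq_mul]
  rw [thetaTerm, Complex.norm_exp, hBh, hβ, hext]
  congr 1
  simp
  ring

/-- For a positive definite symmetric bilinear form `Bℝ` on `ℝⁿ` taking integer values on
`ℤⁿ`, with ℂ-bilinear extension `B`, every level `k ≥ 1` theta series converges absolutely:
the family `β ↦ exp(2πik·B(β, h) + πik·τ·B(β, β))` over `β ∈ ℤⁿ` is summable for every
`τ ∈ ℍ` and `h ∈ ℂⁿ`. -/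
theorem statement7 (n : ℕ) (hn : 1 ≤ n)
    (Bℝ : (Fin n → ℝ) →ₗ[ℝ] (Fin n → ℝ) →ₗ[ℝ] ℝ)
    (hsymm : ∀ x y : Fin n → ℝ, Bℝ x y = Bℝ y x)
    (hpos : ∀ x : Fin n → ℝ, x ≠ 0 → 0 < Bℝ x x)
    (hint : ∀ β γ : Fin n → ℤ, ∃ m : ℤ,
      Bℝ (fun i => (β i : ℝ)) (fun i => (γ i : ℝ)) = (m : ℝ))
    (B : (Fin n → ℂ) →ₗ[ℂ] (Fin n → ℂ) →ₗ[ℂ] ℂ)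
    (hext : ∀ x y : Fin n → ℝ, B (rc x) (rc y) = (Bℝ x y : ℂ))
    (k : ℤ) (hk : 1 ≤ k)
    (τ : ℂ) (hτ : 0 < τ.im) (h : Fin n → ℂ) :
    Summable (fun β : Fin n → ℤ => thetaTerm B k τ h β) := by
  obtain ⟨c, hc, hle⟩ := exists_pos_mul_sum_sq_le Bℝ hpos
  have hk' : (0 : ℝ) < k := by exact_mod_cast hk
  have ha : 0 < Real.pi * k * τ.im * c := by positivity
  let L : (Fin n → ℝ) →ₗ[ℝ] ℝ := Bℝ.flip fun i => (h i).im
  let b : Fin n → ℝ := fun i => -(2 * Real.pi * k) * L (Pi.single i 1)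
  refine Summable.of_norm_bounded
    (summable_prod_apply_of_nonneg
      (fun i (m : ℤ) => Real.exp (-(Real.pi * k * τ.im * c) * (m : ℝ) ^ 2 + b i * m))
      (fun _ _ => (Real.exp_pos _).le)
      fun i => summable_exp_neg_mul_sq_add_mul_int ha (b i)) fun β => ?_
  rw [norm_thetaTerm hext, ← Real.exp_sum, Real.exp_le_exp, Finset.sum_add_distrib,
    ← Finset.mul_sum]
  have hL : -(2 * Real.pi * k) * Bℝ (fun i => (β i : ℝ)) (fun i => (h i).im)
      = ∑ i, b i * β i := by
    change _ * L (fun i => (β i : ℝ)) = _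
    rw [LinearMap.pi_apply_eq_sum_univ L, Finset.mul_sum]
    refine Finset.sum_congr rfl fun i _ => ?_
    have hsingle : (fun j => if i = j then (1 : ℝ) else 0) = Pi.single i 1 := by
      ext j
      simp [Pi.single_apply, eq_comm]
    simp only [b, hsingle, smul_eq_mul]
    ring
  have hq := mul_le_mul_of_nonneg_left (hle fun i => (β i : ℝ))
    (by positivity : 0 ≤ Real.pi * k * τ.im)
  rw [hL]
  linarith
end
end

section
/- Let n ≥ 1 and let B be a symmetric bilinear form on ℝⁿ that is positive definite and takes integer values on the lattice ℤⁿ. Then for every integer k ≥ 1, every τ ∈ ℍ, every h ∈ ℂⁿ and every lattice vector γ ∈ ℤⁿ, one has θ_k(τ, h + τ·γ) = exp(−2πik·B(γ, h) − πik·τ·B(γ, γ)) · θ_k(τ, h); equivalently θ_k(τ, h) = exp(2πik·B(γ, h) + πik·τ·B(γ, γ)) · θ_k(τ, h + τ·γ). -/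
noncomputable section

/-- Translating `h` by `τ·γ` shifts the summation index by `γ`, up to an exponential factor. -/
theorem thetaTerm_add_smul_zc {n : ℕ} (B : (Fin n → ℂ) →ₗ[ℂ] (Fin n → ℂ) →ₗ[ℂ] ℂ)
    (hsymm : ∀ β γ : Fin n → ℤ, B (zc β) (zc γ) = B (zc γ) (zc β))
    (k : ℤ) (τ : ℂ) (h : Fin n → ℂ) (γ β : Fin n → ℤ) :
    thetaTerm B k τ (h + τ • zc γ) β
      = Complex.exp (-(2 * (Real.pi : ℂ) * Complex.I * (k : ℂ) * B (zc γ) h)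
          - (Real.pi : ℂ) * Complex.I * (k : ℂ) * τ * B (zc γ) (zc γ))
          * thetaTerm B k τ h (β + γ) := by
  simp only [thetaTerm, zc_add, map_add, map_smul, LinearMap.add_apply, smul_eq_mul,
    ← Complex.exp_add, hsymm γ β]
  congr 1
  ring

theorem theta_add_smul_zc {n : ℕ} (B : (Fin n → ℂ) →ₗ[ℂ] (Fin n → ℂ) →ₗ[ℂ] ℂ)
    (hsymm : ∀ β γ : Fin n → ℤ, B (zc β) (zc γ) = B (zc γ) (zc β))
    (k : ℤ) (τ : ℂ) (h : Fin n → ℂ) (γ : Fin n → ℤ) :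
    theta B k τ (h + τ • zc γ)
      = Complex.exp (-(2 * (Real.pi : ℂ) * Complex.I * (k : ℂ) * B (zc γ) h)
          - (Real.pi : ℂ) * Complex.I * (k : ℂ) * τ * B (zc γ) (zc γ)) * theta B k τ h := by
  simp only [theta, thetaTerm_add_smul_zc B hsymm, tsum_mul_left]
  congr 1
  exact (Equiv.addRight γ).tsum_eq (thetaTerm B k τ h)

/-- The quasi-periodicity of the theta function in the `τ·ℤⁿ` directions: for every
`γ ∈ ℤⁿ`, `θ_k(τ, h + τ·γ) = exp(−2πik·B(γ, h) − πik·τ·B(γ, γ))·θ_k(τ, h)`; equivalently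
`θ_k(τ, h) = exp(2πik·B(γ, h) + πik·τ·B(γ, γ))·θ_k(τ, h + τ·γ)`. -/
theorem statement9 (n : ℕ) (hn : 1 ≤ n)
    (Bℝ : (Fin n → ℝ) →ₗ[ℝ] (Fin n → ℝ) →ₗ[ℝ] ℝ)
    (hsymm : ∀ x y : Fin n → ℝ, Bℝ x y = Bℝ y x)
    (hpos : ∀ x : Fin n → ℝ, x ≠ 0 → 0 < Bℝ x x)
    (hint : ∀ β γ : Fin n → ℤ, ∃ m : ℤ,
      Bℝ (fun i => (β i : ℝ)) (fun i => (γ i : ℝ)) = (m : ℝ))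
    (B : (Fin n → ℂ) →ₗ[ℂ] (Fin n → ℂ) →ₗ[ℂ] ℂ)
    (hext : ∀ x y : Fin n → ℝ, B (rc x) (rc y) = (Bℝ x y : ℂ))
    (k : ℤ) (hk : 1 ≤ k)
    (τ : ℂ) (hτ : 0 < τ.im) (h : Fin n → ℂ) (γ : Fin n → ℤ) :
    theta B k τ (h + τ • zc γ)
        = Complex.exp (-(2 * (Real.pi : ℂ) * Complex.I * (k : ℂ) * B (zc γ) h)
            - (Real.pi : ℂ) * Complex.I * (k : ℂ) * τ * B (zc γ) (zc γ)) * theta B k τ h ∧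
      theta B k τ h
        = Complex.exp (2 * (Real.pi : ℂ) * Complex.I * (k : ℂ) * B (zc γ) h
            + (Real.pi : ℂ) * Complex.I * (k : ℂ) * τ * B (zc γ) (zc γ))
            * theta B k τ (h + τ • zc γ) := by
  have hB : ∀ β γ : Fin n → ℤ, B (zc β) (zc γ) = B (zc γ) (zc β) := fun β γ => by
    have hzc : ∀ δ : Fin n → ℤ, zc δ = rc fun i => (δ i : ℝ) := fun δ => by
      ext i
      simp [zc, rc]
    rw [hzc, hzc, hext, hext, hsymm]
  have hθ := theta_add_smul_zc B hB k τ h γ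
  refine ⟨hθ, ?_⟩
  rw [hθ, ← mul_assoc, ← Complex.exp_add]
  ring_nf
  simp
end
end

section
/- Let n ≥ 1, τ ∈ ℍ and h ∈ ℂⁿ. (i) There exist unique vectors h₁, h₂ ∈ ℝⁿ with h = −τ·h₁ + h₂. (ii) Moreover, let A = !![a, b; c, d] ∈ SL(2, ℤ), set τ' = (aτ + b)/(cτ + d) ∈ ℍ and h' = h/(cτ + d), and let ĥ₁, ĥ₂ ∈ ℝⁿ be the unique vectors with h' = −τ'·ĥ₁ + ĥ₂. Then a·ĥ₁ − c·ĥ₂ = h₁ and d·ĥ₂ − b·ĥ₁ = h₂; equivalently ĥ₁ = d·h₁ + c·h₂ and ĥ₂ = b·h₁ + a·h₂. -/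
noncomputable section

/-- `1` and `τ` are linearly independent over `ℝ`, in the form used for coordinates. -/
theorem neg_mul_add_ofReal_inj {τ : ℂ} (hτ : τ.im ≠ 0) {x y x' y' : ℝ} :
    -(τ * x) + y = -(τ * x') + y' ↔ x = x' ∧ y = y' := by
  refine ⟨fun e => ?_, by rintro ⟨rfl, rfl⟩; rfl⟩
  have him := congrArg Complex.im e
  have hre := congrArg Complex.re e
  simp only [Complex.add_im, Complex.add_re, Complex.neg_im, Complex.neg_re, Complex.re_mul_ofReal,
    Complex.im_mul_ofReal, Complex.ofReal_im, Complex.ofReal_re, add_zero, neg_inj] at him hre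
  obtain rfl := mul_left_cancel₀ hτ him
  exact ⟨rfl, add_left_cancel hre⟩

theorem neg_smul_rc_add_rc_inj {n : ℕ} {τ : ℂ} (hτ : τ.im ≠ 0) {x y x' y' : Fin n → ℝ} :
    -(τ • rc x) + rc y = -(τ • rc x') + rc y' ↔ x = x' ∧ y = y' := by
  simp only [funext_iff, Pi.add_apply, Pi.neg_apply, Pi.smul_apply, smul_eq_mul, rc,
    neg_mul_add_ofReal_inj hτ, forall_and]

theorem exists_eq_neg_smul_rc_add_rc {n : ℕ} {τ : ℂ} (hτ : τ.im ≠ 0) (h : Fin n → ℂ) :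
    ∃ x y : Fin n → ℝ, h = -(τ • rc x) + rc y := by
  refine ⟨fun i => -((h i).im / τ.im), fun i => (h i).re - τ.re * ((h i).im / τ.im), ?_⟩
  ext i
  apply Complex.ext
  · simp [rc]
  · simp [rc, mul_div_cancel₀ _ hτ]

theorem int_mul_add_int_ne_zero {τ : ℂ} (hτ : τ.im ≠ 0) {a b c d : ℤ}
    (hdet : a * d - b * c = 1) : (c : ℂ) * τ + d ≠ 0 := by
  intro e
  have him := congrArg Complex.im e
  have hre := congrArg Complex.re e
  have hc : c = 0 := by simpa [hτ] using him
  subst hc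
  have hd : d = 0 := by simpa using hre
  simp [hd] at hdet

/-- (i) Every `h ∈ ℂⁿ` decomposes uniquely as `h = −τ·h₁ + h₂` with `h₁, h₂ ∈ ℝⁿ`, for
`τ ∈ ℍ`. (ii) If `A = !![a, b; c, d] ∈ SL(2, ℤ)`, `τ' = (aτ + b)/(cτ + d)`,
`h' = h/(cτ + d)` and `h' = −τ'·ĥ₁ + ĥ₂` with `ĥ₁, ĥ₂ ∈ ℝⁿ` (written `h₁', h₂'` below), then
`a·ĥ₁ − c·ĥ₂ = h₁` and `d·ĥ₂ − b·ĥ₁ = h₂`; equivalently `ĥ₁ = d·h₁ + c·h₂` and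
`ĥ₂ = b·h₁ + a·h₂`. -/
theorem statement13 (n : ℕ) (hn : 1 ≤ n) (τ : ℂ) (hτ : 0 < τ.im) (h : Fin n → ℂ) :
    (∃! p : (Fin n → ℝ) × (Fin n → ℝ), h = -(τ • rc p.1) + rc p.2) ∧
    (∀ a b c d : ℤ, a * d - b * c = 1 →
      ∀ h₁ h₂ h₁' h₂' : Fin n → ℝ,
        h = -(τ • rc h₁) + rc h₂ →
        ((((c : ℂ) * τ + (d : ℂ))⁻¹) • h
          = -((((a : ℂ) * τ + (b : ℂ)) / ((c : ℂ) * τ + (d : ℂ))) • rc h₁') + rc h₂') →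
        (a • h₁' - c • h₂' = h₁ ∧ d • h₂' - b • h₁' = h₂ ∧
          h₁' = d • h₁ + c • h₂ ∧ h₂' = b • h₁ + a • h₂)) := by
  have hτ' := hτ.ne'
  refine ⟨?_, fun a b c d hdet h₁ h₂ h₁' h₂' hh hh' => ?_⟩
  · obtain ⟨x, y, hxy⟩ := exists_eq_neg_smul_rc_add_rc hτ' h
    exact ⟨(x, y), hxy, fun p hp =>
      Prod.ext_iff.2 ((neg_smul_rc_add_rc_inj hτ').1 (hp.symm.trans hxy))⟩
  · have hne := int_mul_add_int_ne_zero hτ' hdet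
    have hdecomp : h = -(τ • rc (a • h₁' - c • h₂')) + rc (d • h₂' - b • h₁') := by
      ext i
      have hi := congrFun hh' i
      simp only [Pi.add_apply, Pi.neg_apply, Pi.smul_apply, smul_eq_mul, rc] at hi
      field_simp at hi
      simp only [Pi.add_apply, Pi.neg_apply, Pi.smul_apply, Pi.sub_apply, Pi.mul_apply,
        Pi.intCast_apply, smul_eq_mul, zsmul_eq_mul, rc]
      push_cast
      linear_combination hi
    obtain ⟨rfl, rfl⟩ := (neg_smul_rc_add_rc_inj hτ').1 (hdecomp.symm.trans hh)
    have hdetR : (a : ℝ) * d - b * c = 1 := mod_cast hdet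
    refine ⟨rfl, rfl, ?_, ?_⟩ <;> ext i <;>
      simp only [Pi.add_apply, Pi.sub_apply, Pi.mul_apply, Pi.intCast_apply, zsmul_eq_mul]
    · linear_combination (-h₁' i) * hdetR
    · linear_combination (-h₂' i) * hdetR
end
end
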